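/- arXiv:2502.12117 — 13 statements merged into one kernel-verified Lean document; each statement's English description precedes it below -/
import Mathlib

section
/- Fix α ∈ [0,1] and x ∈ [0,1]. (i) If α·(1−x) < 1, then the function y ↦ x·y / (1 − α·(1−x)·(1−y)) is concave on [0,1]. (ii) The function y ↦ x·y·(1 + α·(1−x)·(1−y)) is concave on [0,1]. (Concavity in the second argument of these copulas means that the conditional distribution F_{1|2}(v|s) = ∂C(F₁(v),F₂(s))/∂s-slice is nonincreasing in the signal, which implies that the conditional expectation E[V|S=s] is nondecreasing in s, i.e., the AMH and FGM predictors satisfy Assumption 1 for any marginals.) -/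
/-- A fractional-linear function `y ↦ k y / (1 - c (1 - y))` with `k ≥ 0` and `0 ≤ c < 1` is
concave on `[0,1]`. -/
theorem concaveOn_mul_div_one_sub_mul {k c : ℝ} (hk : 0 ≤ k) (hc : 0 ≤ c) (hc1 : c < 1) :
    ConcaveOn ℝ (Set.Icc (0:ℝ) 1) (fun y => k * y / (1 - c * (1 - y))) := by
  have pos : ∀ y ∈ Set.Icc (0:ℝ) 1, 0 < 1 - c * (1 - y) := fun y hy => by
    nlinarith [mul_nonneg hc hy.1]
  refine ⟨convex_Icc 0 1, fun p hp q hq a b ha hb hab => ?_⟩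
  have hm := pos _ (convex_Icc (0:ℝ) 1 hp hq ha hb hab)
  have hp' := pos p hp
  have hq' := pos q hq
  obtain rfl : b = 1 - a := by linarith
  simp only [smul_eq_mul] at hm ⊢
  have gap : k * (a * p + (1 - a) * q) / (1 - c * (1 - (a * p + (1 - a) * q))) -
      (a * (k * p / (1 - c * (1 - p))) + (1 - a) * (k * q / (1 - c * (1 - q)))) =
      k * (a * (1 - a)) * (c * (1 - c)) * (p - q) ^ 2 /
        ((1 - c * (1 - p)) * (1 - c * (1 - q)) * (1 - c * (1 - (a * p + (1 - a) * q)))) := by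
    rw [← mul_div_assoc, ← mul_div_assoc, div_add_div _ _ hp'.ne' hq'.ne',
      div_sub_div _ _ hm.ne' (mul_pos hp' hq').ne',
      div_eq_div_iff (by positivity) (by positivity)]
    ring
  have hc' : 0 ≤ 1 - c := by linarith
  rw [← sub_nonneg, gap]
  positivity

/-- The quadratic `y ↦ k y (1 + c (1 - y))` with `k, c ≥ 0` is concave on `[0,1]`. -/
theorem concaveOn_mul_one_add_mul {k c : ℝ} (hk : 0 ≤ k) (hc : 0 ≤ c) :
    ConcaveOn ℝ (Set.Icc (0:ℝ) 1) (fun y => k * y * (1 + c * (1 - y))) := by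
  refine ⟨convex_Icc 0 1, fun p _ q _ a b ha hb hab => ?_⟩
  obtain rfl : b = 1 - a := by linarith
  simp only [smul_eq_mul]
  have gap : 0 ≤ k * c * (a * (1 - a)) * (p - q) ^ 2 := by positivity
  linarith

/-- The AMH copula (when its denominator is positive) and the FGM copula are concave in their
second argument on `[0,1]`; this implies the corresponding predictors satisfy Assumption 1. -/
theorem stmt_1 (α x : ℝ) (hα : α ∈ Set.Icc (0:ℝ) 1) (hx : x ∈ Set.Icc (0:ℝ) 1) :
    (α * (1 - x) < 1 →
      ConcaveOn ℝ (Set.Icc (0:ℝ) 1) (fun y => x * y / (1 - α * (1 - x) * (1 - y)))) ∧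
    ConcaveOn ℝ (Set.Icc (0:ℝ) 1) (fun y => x * y * (1 + α * (1 - x) * (1 - y))) := by
  have hc : 0 ≤ α * (1 - x) := mul_nonneg hα.1 (sub_nonneg.2 hx.2)
  exact ⟨concaveOn_mul_div_one_sub_mul hx.1 hc, concaveOn_mul_one_add_mul hx.1 hc⟩
end

section
/- Let m, n be integers with 2 ≤ n ≤ m−2, let a ∈ [0,1], and let φ:[0,1]→ℝ be twice continuously differentiable with φ(1) = a and φ''(t) ≤ 0 for all t ∈ [0,1]. Then C(m,n+1)·(m−n−1)·∫₀¹ (a−φ(t))·(1−t)ⁿ·t^{m−n−2} dt ≥ C(m,n)·(m−n)·∫₀¹ (a−φ(t))·(1−t)^{n−1}·t^{m−n−1} dt, where C(a,b) denotes the binomial coefficient. -/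
open intervalIntegral in
/-- The kernel of the single-crossing argument is an exact derivative vanishing at both ends. -/
lemma integral_crossing_kernel_eq_zero (k q : ℕ) :
    ∫ t in (0:ℝ)..1, (((q:ℝ) + 1) * (1 - t) - ((k:ℝ) + 2) * t) * ((1 - t) ^ (k + 1) * t ^ q)
      = 0 := by
  have hderiv : ∀ t ∈ Set.uIcc (0:ℝ) 1, HasDerivAt (fun t : ℝ => (1 - t) ^ (k + 2) * t ^ (q + 1))
      ((((q:ℝ) + 1) * (1 - t) - ((k:ℝ) + 2) * t) * ((1 - t) ^ (k + 1) * t ^ q)) t := by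
    intro t _
    have h := (((hasDerivAt_id t).const_sub 1).pow (k + 2)).mul ((hasDerivAt_id t).pow (q + 1))
    refine h.congr_deriv ?_
    simp only [id, Pi.pow_apply, Nat.add_sub_cancel, show k + 2 - 1 = k + 1 from rfl]
    push_cast
    ring
  rw [integral_eq_sub_of_hasDerivAt hderiv (Continuous.intervalIntegrable (by fun_prop) _ _)]
  simp

/-- A convex function vanishing at `1` lies above or below the chord through `(t₀, h t₀)` and
`(1, 0)` according to the side of `t₀`. -/
lemma ConvexOn.chord_crossing {h : ℝ → ℝ} (hc : ConvexOn ℝ (Set.Icc 0 1) h) (h1 : h 1 = 0)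
    {s t : ℝ} (hs : 0 ≤ s) (hst : s ≤ t) (ht : t ≤ 1) :
    h t * (1 - s) ≤ h s * (1 - t) := by
  rcases (hst.trans ht).eq_or_lt with rfl | hs1
  · obtain rfl : t = 1 := le_antisymm ht hst
    simp
  have hpos : 0 < 1 - s := sub_pos.2 hs1
  have h2 := hc.2 (x := s) (y := 1) ⟨hs, hs1.le⟩ ⟨zero_le_one, le_rfl⟩
    (div_nonneg (sub_nonneg.2 ht) hpos.le) (div_nonneg (sub_nonneg.2 hst) hpos.le)
    (by field_simp; ring)
  have h3 : ((1 - t) / (1 - s)) • s + ((t - s) / (1 - s)) • (1:ℝ) = t := by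
    simp only [smul_eq_mul]; field_simp; ring
  rw [h3, h1, smul_zero, add_zero, smul_eq_mul] at h2
  calc h t * (1 - s) ≤ (1 - t) / (1 - s) * h s * (1 - s) := by gcongr
    _ = h s * (1 - t) := by field_simp

open intervalIntegral in
lemma ConvexOn.integral_beta_weight_le {h : ℝ → ℝ} (hc : ConvexOn ℝ (Set.Icc 0 1) h)
    (hcont : Continuous h) (h1 : h 1 = 0) (k q : ℕ) :
    ((k:ℝ) + 2) * ∫ t in (0:ℝ)..1, h t * (1 - t) ^ k * t ^ (q + 1)
      ≤ ((q:ℝ) + 1) * ∫ t in (0:ℝ)..1, h t * (1 - t) ^ (k + 1) * t ^ q := by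
  set s : ℝ := ((q:ℝ) + 1) / (k + q + 3) with hs
  have hd : (0:ℝ) < k + q + 3 := by positivity
  have hs0 : 0 ≤ s := by positivity
  have hs1 : 0 < 1 - s := by
    rw [hs, sub_pos, div_lt_one hd]; linarith [(Nat.cast_nonneg k : (0:ℝ) ≤ k)]
  have hker (t : ℝ) :
      ((q:ℝ) + 1) * (1 - t) - ((k:ℝ) + 2) * t = (k + q + 3) * (s - t) := by
    rw [hs]; field_simp; ring
  have hmono : ∫ t in (0:ℝ)..1, h s *
        ((((q:ℝ) + 1) * (1 - t) - ((k:ℝ) + 2) * t) * ((1 - t) ^ (k + 1) * t ^ q))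
      ≤ ∫ t in (0:ℝ)..1, (1 - s) * (((q:ℝ) + 1) * (h t * (1 - t) ^ (k + 1) * t ^ q)
        - ((k:ℝ) + 2) * (h t * (1 - t) ^ k * t ^ (q + 1))) := by
    refine integral_mono_on zero_le_one (Continuous.intervalIntegrable (by fun_prop) _ _)
      (Continuous.intervalIntegrable (by fun_prop) _ _) fun t ht => ?_
    have hw : 0 ≤ (k + q + 3) * ((1 - t) ^ k * t ^ q) :=
      mul_nonneg hd.le (mul_nonneg (pow_nonneg (sub_nonneg.2 ht.2) _) (pow_nonneg ht.1 _))
    have hcross : 0 ≤ (s - t) * (h t * (1 - s) - h s * (1 - t)) := by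
      rcases le_total t s with hts | hts
      · exact mul_nonneg (sub_nonneg.2 hts)
          (sub_nonneg.2 (hc.chord_crossing h1 ht.1 hts (sub_nonneg.1 hs1.le)))
      · exact mul_nonneg_of_nonpos_of_nonpos (sub_nonpos.2 hts)
          (sub_nonpos.2 (hc.chord_crossing h1 hs0 hts ht.2))
    have hsplit : (1 - s) * (((q:ℝ) + 1) * (h t * (1 - t) ^ (k + 1) * t ^ q)
        - ((k:ℝ) + 2) * (h t * (1 - t) ^ k * t ^ (q + 1)))
        = (1 - s) * h t * ((((q:ℝ) + 1) * (1 - t) - ((k:ℝ) + 2) * t) * ((1 - t) ^ k * t ^ q)) := by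
      ring
    rw [hsplit, hker, ← sub_nonneg]
    refine (mul_nonneg hw hcross).trans_eq ?_
    ring
  rw [integral_const_mul, integral_crossing_kernel_eq_zero, mul_zero, integral_const_mul,
    integral_sub (Continuous.intervalIntegrable (by fun_prop) _ _)
      (Continuous.intervalIntegrable (by fun_prop) _ _), integral_const_mul,
    integral_const_mul] at hmono
  exact sub_nonneg.1 (nonneg_of_mul_nonneg_right hmono hs1)


/-- Analytic core of Lemma 3(i): the marginal CDF of an admitted bidder's valuation increases
with the admitted number `n`, for a copula slice `φ` that is concave (PRD condition). -/
theorem stmt_2 (m n : ℕ) (hn : 2 ≤ n) (hnm : n + 2 ≤ m) (a : ℝ) (ha : a ∈ Set.Icc (0:ℝ) 1)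
    (φ : ℝ → ℝ) (hφ : ContDiff ℝ 2 φ) (hφ1 : φ 1 = a)
    (hconc : ∀ t ∈ Set.Icc (0:ℝ) 1, deriv (deriv φ) t ≤ 0) :
    (m.choose (n + 1) : ℝ) * ((m - n - 1 : ℕ) : ℝ) *
        (∫ t in (0:ℝ)..1, (a - φ t) * (1 - t) ^ n * t ^ (m - n - 2))
      ≥ (m.choose n : ℝ) * ((m - n : ℕ) : ℝ) *
        (∫ t in (0:ℝ)..1, (a - φ t) * (1 - t) ^ (n - 1) * t ^ (m - n - 1)) := by
  obtain ⟨k, rfl⟩ : ∃ k, n = k + 1 := ⟨n - 1, by omega⟩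
  obtain ⟨q, rfl⟩ : ∃ q, m = k + 1 + 2 + q := Nat.exists_eq_add_of_le hnm
  have hconcave : ConcaveOn ℝ (Set.Icc 0 1) φ := by
    refine concaveOn_of_deriv2_nonpos (convex_Icc 0 1) hφ.continuous.continuousOn
      (hφ.differentiable (by norm_num)).differentiableOn ?_ fun t ht => ?_
    · exact ((hφ.iterate_deriv' 1 1).differentiable (by norm_num)).differentiableOn
    · exact hconc t (interior_subset ht)
  have hconvex : ConvexOn ℝ (Set.Icc 0 1) fun t => a - φ t :=
    (convexOn_const a (convex_Icc 0 1)).sub hconcave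
  have hle := hconvex.integral_beta_weight_le (continuous_const.sub hφ.continuous)
    (by simp [hφ1]) k q
  have hchoose := Nat.choose_succ_right_eq (k + 1 + 2 + q) (k + 1)
  have e1 : k + 1 + 2 + q - (k + 1) = q + 2 := by omega
  have e2 : k + 1 + 2 + q - (k + 1) - 1 = q + 1 := by omega
  have e3 : k + 1 + 2 + q - (k + 1) - 2 = q := by omega
  rw [e1] at hchoose
  rw [e2, e3, e1, Nat.add_sub_cancel, ← Nat.cast_mul (Nat.choose _ (k + 1)), ← hchoose]
  push_cast
  have := mul_le_mul_of_nonneg_left hle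
    (Nat.cast_nonneg (α := ℝ) ((k + 1 + 2 + q).choose (k + 1 + 1)))
  linarith
end

section
/- Let m, n, k be integers with 1 ≤ k ≤ n and n + 2 ≤ m, let a ∈ [0,1], and let φ:[0,1]→ℝ be continuously differentiable with φ(1) = a and 0 ≤ φ'(t) ≤ 1 for all t ∈ [0,1]. Set A(t) := a − φ(t). Then Σ_{i=0}^{k−1} C(n+1,i)·C(m,n+1)·(m−n−1)·∫₀¹ A(t)^{n+1−i}·(1−t−A(t))^{i}·t^{m−n−2} dt ≤ Σ_{i=0}^{k−1} C(n,i)·C(m,n)·(m−n)·∫₀¹ A(t)^{n−i}·(1−t−A(t))^{i}·t^{m−n−1} dt, where C(a,b) denotes the binomial coefficient. -/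
/-- The first `k` terms of the binomial expansion of `(x + y) ^ n`. -/
def binomialPartialSum (n k : ℕ) (x y : ℝ) : ℝ :=
  ∑ i ∈ Finset.range k, (n.choose i : ℝ) * x ^ (n - i) * y ^ i

theorem binomialPartialSum_succ (n k : ℕ) (x y : ℝ) :
    binomialPartialSum n (k + 1) x y =
      binomialPartialSum n k x y + (n.choose k : ℝ) * x ^ (n - k) * y ^ k :=
  Finset.sum_range_succ _ _

theorem binomialPartialSum_zero_zero {n k : ℕ} (hn : n ≠ 0) :
    binomialPartialSum n k 0 0 = 0 := by
  refine Finset.sum_eq_zero fun i _ => ?_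
  rcases eq_or_ne i 0 with rfl | hi
  · simp [hn]
  · simp [hi]

theorem continuous_binomialPartialSum (n k : ℕ) {f g : ℝ → ℝ} (hf : Continuous f)
    (hg : Continuous g) : Continuous fun t => binomialPartialSum n k (f t) (g t) := by
  unfold binomialPartialSum
  fun_prop

theorem hasDerivAt_binomialPartialSum (n k : ℕ) {f g : ℝ → ℝ} {f' g' t : ℝ}
    (hf : HasDerivAt f f' t) (hg : HasDerivAt g g' t) :
    HasDerivAt (fun s => binomialPartialSum (n + 1) (k + 1) (f s) (g s))
      ((n + 1) * (f' * binomialPartialSum n (k + 1) (f t) (g t) +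
        g' * binomialPartialSum n k (f t) (g t))) t := by
  induction k with
  | zero =>
    simp only [binomialPartialSum, zero_add, Finset.sum_range_one, Finset.sum_range_zero,
      Nat.choose_zero_right, Nat.cast_one, one_mul, pow_zero, mul_one, mul_zero, add_zero,
      Nat.sub_zero]
    refine (hf.fun_pow (n + 1)).congr_deriv ?_
    rw [Nat.add_sub_cancel]
    push_cast
    ring
  | succ k ih =>
    have h₁ : ((n + 1).choose (k + 1) : ℝ) * (k + 1) = (n + 1) * n.choose k := by
      exact_mod_cast (Nat.add_one_mul_choose_eq n k).symm
    have h₂ : ((n + 1).choose (k + 1) : ℝ) * ((n - k : ℕ) : ℝ) =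
        n.choose (k + 1) * (n + 1) := by
      have h := (Nat.choose_mul_succ_eq n (k + 1)).symm
      rw [Nat.add_sub_add_right] at h
      exact_mod_cast h
    have hterm := ((hf.fun_pow (n - k)).const_mul ((n + 1).choose (k + 1) : ℝ)).fun_mul
      (hg.fun_pow (k + 1))
    simp only [binomialPartialSum_succ _ (k + 1), Nat.add_sub_add_right]
    refine (ih.fun_add hterm).congr_deriv ?_
    rw [binomialPartialSum_succ n k, Nat.sub_add_eq]
    simp only [Nat.add_sub_cancel, Nat.cast_add, Nat.cast_one]
    linear_combination f t ^ (n - k - 1) * f' * g t ^ (k + 1) * h₂ +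
      f t ^ (n - k) * g t ^ k * g' * h₁

theorem sum_mul_integral_eq_integral_binomialPartialSum (n k l : ℕ) (c d : ℝ) {f g : ℝ → ℝ}
    (hf : Continuous f) (hg : Continuous g) :
    ∑ i ∈ Finset.range k, (n.choose i : ℝ) * c * d *
        (∫ t in (0:ℝ)..1, f t ^ (n - i) * g t ^ i * t ^ l) =
      ∫ t in (0:ℝ)..1, c * d * (binomialPartialSum n k (f t) (g t) * t ^ l) := by
  simp only [← intervalIntegral.integral_const_mul]
  rw [← intervalIntegral.integral_finsetSum]
  · congr 1
    ext t
    simp only [binomialPartialSum, Finset.sum_mul, Finset.mul_sum]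
    exact Finset.sum_congr rfl fun i _ => by ring
  · exact fun i _ => Continuous.intervalIntegrable (by fun_prop) _ _

/-- Integration by parts, combined with a pointwise bound on the derivative of the
partial sum, when `f` and `g` are nonnegative on
`[0, 1]`, vanish at `1`, and satisfy `f' + g' = -1` with `g' ≤ 0`. -/
theorem integral_binomialPartialSum_succ_le (n k l : ℕ) {f g f' g' : ℝ → ℝ}
    (hf : ∀ t, HasDerivAt f (f' t) t) (hg : ∀ t, HasDerivAt g (g' t) t)
    (hf'c : Continuous f') (hg'c : Continuous g')
    (hf0 : ∀ t ∈ Set.Icc (0:ℝ) 1, 0 ≤ f t) (hg0 : ∀ t ∈ Set.Icc (0:ℝ) 1, 0 ≤ g t)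
    (hg' : ∀ t ∈ Set.Icc (0:ℝ) 1, g' t ≤ 0) (hsum : ∀ t, f' t + g' t = -1)
    (hf1 : f 1 = 0) (hg1 : g 1 = 0) :
    ∫ t in (0:ℝ)..1, ((l + 1 : ℕ) : ℝ) *
        (binomialPartialSum (n + 1) (k + 1) (f t) (g t) * t ^ l) ≤
      ∫ t in (0:ℝ)..1, ((n + 1 : ℕ) : ℝ) *
        (binomialPartialSum n (k + 1) (f t) (g t) * t ^ (l + 1)) := by
  have hfc : Continuous f := continuous_iff_continuousAt.2 fun t => (hf t).continuousAt
  have hgc : Continuous g := continuous_iff_continuousAt.2 fun t => (hg t).continuousAt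
  have hP := continuous_binomialPartialSum (n + 1) (k + 1) hfc hgc
  have hQ := continuous_binomialPartialSum n (k + 1) hfc hgc
  have hR := continuous_binomialPartialSum n k hfc hgc
  have hderiv (t : ℝ) :=
    (hasDerivAt_binomialPartialSum n k (hf t) (hg t)).mul (hasDerivAt_pow (l + 1) t)
  have hzero := intervalIntegral.integral_eq_sub_of_hasDerivAt (a := 0) (b := 1)
    (fun t _ => hderiv t) (Continuous.intervalIntegrable (by fun_prop) _ _)
  simp only [Pi.mul_apply, hf1, hg1, binomialPartialSum_zero_zero (Nat.succ_ne_zero n), zero_mul,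
    zero_pow (Nat.succ_ne_zero l), mul_zero, sub_zero] at hzero
  refine le_of_le_of_eq ?_ (add_eq_left.2 hzero)
  rw [← intervalIntegral.integral_add (Continuous.intervalIntegrable (by fun_prop) _ _)
      (Continuous.intervalIntegrable (by fun_prop) _ _)]
  refine intervalIntegral.integral_mono_on zero_le_one
    (Continuous.intervalIntegrable (by fun_prop) _ _)
    (Continuous.intervalIntegrable (by fun_prop) _ _) fun t ht => ?_
  have hx := hf0 t ht
  have hy := hg0 t ht
  have ht0 := ht.1
  have hg't : 0 ≤ -g' t := neg_nonneg.2 (hg' t ht)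
  have hslack : 0 ≤ (n + 1) * (-g' t * ((n.choose k : ℝ) * f t ^ (n - k) * g t ^ k)) *
      t ^ (l + 1) := by positivity
  rw [binomialPartialSum_succ n k, Nat.add_sub_cancel, eq_sub_of_add_eq (hsum t)]
  push_cast
  linarith


/-- Analytic core of Lemma 3(ii): the CDF of the `k`-th largest valuation among the admitted
bidders decreases pointwise when the admitted number increases from `n` to `n+1`, for a copula
slice `φ` with derivative in `[0,1]`. -/
theorem stmt_3 (m n k : ℕ) (hk : 1 ≤ k) (hkn : k ≤ n) (hm : n + 2 ≤ m)
    (a : ℝ) (ha : a ∈ Set.Icc (0:ℝ) 1) (φ : ℝ → ℝ) (hφ : ContDiff ℝ 1 φ) (hφ1 : φ 1 = a)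
    (hd : ∀ t ∈ Set.Icc (0:ℝ) 1, 0 ≤ deriv φ t ∧ deriv φ t ≤ 1) :
    ∑ i ∈ Finset.range k, ((n + 1).choose i : ℝ) * (m.choose (n + 1) : ℝ) *
        ((m - n - 1 : ℕ) : ℝ) *
        (∫ t in (0:ℝ)..1, (a - φ t) ^ (n + 1 - i) * (1 - t - (a - φ t)) ^ i * t ^ (m - n - 2))
      ≤ ∑ i ∈ Finset.range k, (n.choose i : ℝ) * (m.choose n : ℝ) * ((m - n : ℕ) : ℝ) *
        (∫ t in (0:ℝ)..1, (a - φ t) ^ (n - i) * (1 - t - (a - φ t)) ^ i * t ^ (m - n - 1)) := by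
  obtain ⟨l, rfl⟩ := Nat.exists_eq_add_of_le hm
  obtain ⟨j, rfl⟩ := Nat.exists_eq_add_of_le' hk
  have hφd : Differentiable ℝ φ := hφ.differentiable one_ne_zero
  have hφc : Continuous φ := hφ.continuous
  have hφ'c : Continuous (deriv φ) := hφ.continuous_deriv le_rfl
  have hf (t : ℝ) : HasDerivAt (fun s => a - φ s) (-deriv φ t) t :=
    (hφd t).hasDerivAt.const_sub a
  have hg (t : ℝ) : HasDerivAt (fun s => 1 - s - (a - φ s)) (-1 - -deriv φ t) t :=
    ((hasDerivAt_id t).const_sub 1).sub (hf t)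
  have hd' : ∀ t ∈ interior (Set.Icc (0:ℝ) 1), 0 ≤ deriv φ t ∧ deriv φ t ≤ 1 :=
    fun t ht => hd t (interior_subset ht)
  have hone : (1:ℝ) ∈ Set.Icc (0:ℝ) 1 := by simp
  have hf0 : ∀ t ∈ Set.Icc (0:ℝ) 1, 0 ≤ a - φ t := fun t ht => by
    have := (convex_Icc (0:ℝ) 1).mul_sub_le_image_sub_of_le_deriv hφc.continuousOn
      hφd.differentiableOn (fun s hs => (hd' s hs).1) t ht 1 hone ht.2
    linarith
  have hg0 : ∀ t ∈ Set.Icc (0:ℝ) 1, 0 ≤ 1 - t - (a - φ t) := fun t ht => by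
    have := (convex_Icc (0:ℝ) 1).image_sub_le_mul_sub_of_deriv_le hφc.continuousOn
      hφd.differentiableOn (fun s hs => (hd' s hs).2) t ht 1 hone ht.2
    linarith
  have key := integral_binomialPartialSum_succ_le n j l hf hg (by fun_prop) (by fun_prop) hf0 hg0
    (fun t ht => by linarith [(hd t ht).2]) (fun t => by ring) (by simp [hφ1]) (by simp [hφ1])
  have hchoose : ((n + 2 + l).choose n : ℝ) * ((l + 2 : ℕ) : ℝ) =
      ((n + 2 + l).choose (n + 1) : ℝ) * ((n + 1 : ℕ) : ℝ) := by
    have h := Nat.choose_succ_right_eq (n + 2 + l) n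
    rw [show n + 2 + l - n = l + 2 by omega] at h
    exact_mod_cast h.symm
  rw [show n + 2 + l - n - 1 = l + 1 by omega, show n + 2 + l - n - 2 = l by omega,
    show n + 2 + l - n = l + 2 by omega,
    sum_mul_integral_eq_integral_binomialPartialSum (n + 1) (j + 1) l _ _ (f := fun t => a - φ t)
      (g := fun t => 1 - t - (a - φ t)) (by fun_prop) (by fun_prop),
    sum_mul_integral_eq_integral_binomialPartialSum n (j + 1) (l + 1) _ _ (f := fun t => a - φ t)
      (g := fun t => 1 - t - (a - φ t)) (by fun_prop) (by fun_prop), hchoose]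
  simpa only [intervalIntegral.integral_const_mul, mul_assoc] using
    mul_le_mul_of_nonneg_left key (Nat.cast_nonneg ((n + 2 + l).choose (n + 1)))
end

section
/- Let n, k be integers with 1 ≤ k ≤ n. (i) For all reals a, b, Σ_{i=0}^{k−1} (n−i)·C(n,i)·a^{n−i−1}·(b−a)^{i} − Σ_{i=1}^{k−1} i·C(n,i)·a^{n−i}·(b−a)^{i−1} = (n+1−k)·C(n,k−1)·a^{n−k}·(b−a)^{k−1}. (ii) Consequently, for all reals 0 ≤ a ≤ a' ≤ b, Σ_{i=0}^{k−1} C(n,i)·a^{n−i}·(b−a)^{i} ≤ Σ_{i=0}^{k−1} C(n,i)·(a')^{n−i}·(b−a')^{i}. Here C(a,b) denotes the binomial coefficient. -/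
/-- The telescoping identity behind the derivative of a partial binomial sum. -/
theorem sum_range_sub_sum_range_choose (n m : ℕ) (a b : ℝ) :
    (∑ i ∈ Finset.range (m + 1),
        ((n - i : ℕ) : ℝ) * (n.choose i : ℝ) * a ^ (n - i - 1) * (b - a) ^ i)
      - (∑ i ∈ Finset.range (m + 1),
          (i : ℝ) * (n.choose i : ℝ) * a ^ (n - i) * (b - a) ^ (i - 1))
    = ((n - m : ℕ) : ℝ) * (n.choose m : ℝ) * a ^ (n - m - 1) * (b - a) ^ m := by
  induction m with
  | zero => simp
  | succ m ih =>
    rw [Finset.sum_range_succ, Finset.sum_range_succ _ (m + 1), add_sub_add_comm, ih]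
    have h : ((n.choose (m + 1) : ℕ) : ℝ) * ((m + 1 : ℕ) : ℝ)
        = (n.choose m : ℝ) * ((n - m : ℕ) : ℝ) := by
      exact_mod_cast Nat.choose_succ_right_eq n m
    rw [Nat.add_sub_cancel, Nat.sub_sub n m 1]
    linear_combination -(a ^ (n - (m + 1)) * (b - a) ^ m) * h

theorem sum_Ico_one_eq_sum_range_natCast_mul (k : ℕ) (hk : 1 ≤ k) (f g h : ℕ → ℝ) :
    ∑ i ∈ Finset.Ico 1 k, (i : ℝ) * f i * g i * h i
      = ∑ i ∈ Finset.range k, (i : ℝ) * f i * g i * h i := by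
  rw [Finset.sum_range_eq_add_Ico _ hk]
  simp

theorem hasDerivAt_sum_range_choose (n m : ℕ) (a b : ℝ) :
    HasDerivAt (fun x : ℝ ↦
        ∑ i ∈ Finset.range (m + 1), (n.choose i : ℝ) * x ^ (n - i) * (b - x) ^ i)
      (((n - m : ℕ) : ℝ) * (n.choose m : ℝ) * a ^ (n - m - 1) * (b - a) ^ m) a := by
  rw [← sum_range_sub_sum_range_choose, ← Finset.sum_sub_distrib]
  refine HasDerivAt.fun_sum fun i _ ↦ ?_
  have h := ((hasDerivAt_pow (n - i) a).const_mul (n.choose i : ℝ)).mul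
    (((hasDerivAt_id a).const_sub b).pow i)
  refine h.congr_deriv ?_
  simp only [id, Pi.pow_apply]
  ring

theorem monotoneOn_sum_range_choose (n m : ℕ) (b : ℝ) :
    MonotoneOn (fun x : ℝ ↦
      ∑ i ∈ Finset.range (m + 1), (n.choose i : ℝ) * x ^ (n - i) * (b - x) ^ i)
      (Set.Icc 0 b) := by
  refine monotoneOn_of_deriv_nonneg (convex_Icc 0 b)
    (fun x _ ↦ (hasDerivAt_sum_range_choose n m x b).continuousAt.continuousWithinAt)
    (fun x _ ↦ (hasDerivAt_sum_range_choose n m x b).differentiableAt.differentiableWithinAt)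
    fun x hx ↦ ?_
  obtain ⟨hx0, hxb⟩ := interior_subset hx
  have hxb' : 0 ≤ b - x := sub_nonneg.2 hxb
  rw [(hasDerivAt_sum_range_choose n m x b).deriv]
  positivity

/-- Key monotonicity for Lemma 3(iii): (i) a telescoping derivative identity for the partial
binomial sum, and (ii) the resulting monotonicity of `a ↦ Σ_{i<k} C(n,i) a^{n−i} (b−a)^i`. -/
theorem stmt_5 (n k : ℕ) (hk : 1 ≤ k) (hkn : k ≤ n) :
    (∀ a b : ℝ,
      (∑ i ∈ Finset.range k,
          ((n - i : ℕ) : ℝ) * (n.choose i : ℝ) * a ^ (n - i - 1) * (b - a) ^ i)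
        - (∑ i ∈ Finset.Ico 1 k,
            (i : ℝ) * (n.choose i : ℝ) * a ^ (n - i) * (b - a) ^ (i - 1))
      = ((n + 1 - k : ℕ) : ℝ) * (n.choose (k - 1) : ℝ) * a ^ (n - k) * (b - a) ^ (k - 1)) ∧
    (∀ a a' b : ℝ, 0 ≤ a → a ≤ a' → a' ≤ b →
      ∑ i ∈ Finset.range k, (n.choose i : ℝ) * a ^ (n - i) * (b - a) ^ i
        ≤ ∑ i ∈ Finset.range k, (n.choose i : ℝ) * a' ^ (n - i) * (b - a') ^ i) := by
  obtain ⟨m, rfl⟩ : ∃ m, k = m + 1 := ⟨k - 1, by omega⟩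
  refine ⟨fun a b ↦ ?_, fun a a' b ha haa' hab ↦ ?_⟩
  · rw [sum_Ico_one_eq_sum_range_natCast_mul _ hk, sum_range_sub_sum_range_choose,
      Nat.add_sub_add_right, Nat.sub_sub, Nat.add_sub_cancel]
  · exact monotoneOn_sum_range_choose n m b ⟨ha, haa'.trans hab⟩ ⟨ha.trans haa', hab⟩ haa'
end

section
/- For all integers 2 ≤ n ≤ m and all y ∈ [0,1], the integral over the cube [0,y]^{n−1} (with respect to Lebesgue measure) of the function u ↦ (min_{1≤i≤n−1} u_i)^{m−n} equals y^{m−1} / C(m−1,n−1), where C(a,b) denotes the binomial coefficient. -/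
open MeasureTheory

lemma integral_pow_mul_sub_pow (y : ℝ) (q k : ℕ) :
    ∫ t in (0 : ℝ)..y, t ^ q * (y - t) ^ k
      = (q.factorial * k.factorial : ℝ) / (q + k + 1).factorial * y ^ (q + k + 1) := by
  induction k generalizing q with
  | zero =>
    have h : (q.factorial : ℝ) ≠ 0 := by positivity
    have h' : (q : ℝ) + 1 ≠ 0 := by positivity
    simp only [pow_zero, mul_one, integral_pow, add_zero, Nat.factorial_succ, Nat.factorial_zero]
    push_cast
    field_simp
    simp
  | succ k ih =>
    have hparts : ∫ t in (0 : ℝ)..y, ((q + 1 : ℝ) * (t ^ q * (y - t) ^ (k + 1))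
        - (k + 1 : ℝ) * (t ^ (q + 1) * (y - t) ^ k)) = 0 := by
      rw [intervalIntegral.integral_eq_sub_of_hasDerivAt
        (f := fun t => t ^ (q + 1) * (y - t) ^ (k + 1))]
      · simp
      · intro t _
        refine ((hasDerivAt_pow (q + 1) t).fun_mul
          (((hasDerivAt_id' t).const_sub y).fun_pow (k + 1))).congr_deriv ?_
        simp only [Nat.add_sub_cancel]
        push_cast
        ring
      · exact Continuous.intervalIntegrable (by fun_prop) _ _
    rw [intervalIntegral.integral_sub (Continuous.intervalIntegrable (by fun_prop) _ _)
      (Continuous.intervalIntegrable (by fun_prop) _ _), intervalIntegral.integral_const_mul,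
      intervalIntegral.integral_const_mul, ih] at hparts
    have h' : (q : ℝ) + 1 ≠ 0 := by positivity
    apply mul_left_cancel₀ h'
    rw [sub_eq_zero.1 hparts, show q + 1 + k + 1 = q + (k + 1) + 1 by ring,
      Nat.factorial_succ q, Nat.factorial_succ k]
    push_cast
    ring

lemma restrict_Icc_pi_le_iInf {k : ℕ} [NeZero k] (y t : ℝ) (ht : 0 ≤ t) :
    (volume.restrict (Set.Icc (0 : Fin k → ℝ) (fun _ => y))) {u | t ≤ ⨅ i, u i}
      = ENNReal.ofReal (y - t) ^ k := by
  have hm : Measurable fun u : Fin k → ℝ => ⨅ i, u i := by fun_prop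
  rw [Measure.restrict_apply (measurableSet_le measurable_const hm)]
  have : {u : Fin k → ℝ | t ≤ ⨅ i, u i} ∩ Set.Icc 0 (fun _ => y)
      = Set.Icc (fun _ => t) (fun _ => y) := by
    ext u
    simp only [Set.mem_inter_iff, Set.mem_ofPred_eq, Set.mem_Icc, Pi.le_def, Pi.zero_apply,
      le_ciInf_iff (Set.finite_range u).bddBelow]
    exact ⟨fun h => ⟨h.1, h.2.2⟩, fun h => ⟨h.1, fun i => ht.trans (h.1 i), h.2⟩⟩
  rw [this, Real.volume_Icc_pi]
  simp

lemma setIntegral_Icc_pi_iInf_pow_succ {k : ℕ} [NeZero k] (q : ℕ) {y : ℝ} (hy : 0 ≤ y) :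
    ∫ u in Set.Icc (0 : Fin k → ℝ) (fun _ => y), (⨅ i, u i) ^ (q + 1)
      = ∫ t in (0 : ℝ)..y, (y - t) ^ k * ((q + 1) * t ^ q) := by
  have hm : Measurable fun u : Fin k → ℝ => ⨅ i, u i := by fun_prop
  have hnn : 0 ≤ᵐ[volume.restrict (Set.Icc (0 : Fin k → ℝ) (fun _ => y))]
      fun u => ⨅ i, u i := by
    filter_upwards [ae_restrict_mem measurableSet_Icc] with u hu
    exact le_ciInf fun i => hu.1 i
  have hint (a : ℝ) : ∫ t in (0 : ℝ)..a, ((q : ℝ) + 1) * t ^ q = a ^ (q + 1) := by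
    have h' : (q : ℝ) + 1 ≠ 0 := by positivity
    rw [intervalIntegral.integral_const_mul, integral_pow]
    field_simp
    simp
  have hlayer := lintegral_comp_eq_lintegral_meas_le_mul
    (volume.restrict (Set.Icc (0 : Fin k → ℝ) (fun _ => y))) hnn hm.aemeasurable
    (g := fun t => ((q : ℝ) + 1) * t ^ q)
    (fun t _ => Continuous.intervalIntegrable (by fun_prop) _ _)
    (by
      filter_upwards [ae_restrict_mem measurableSet_Ioi] with t ht
      have : (0 : ℝ) < t := ht
      positivity)
  simp only [hint] at hlayer
  rw [integral_eq_lintegral_of_nonneg_ae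
      (by filter_upwards [hnn] with u hu using pow_nonneg hu _)
      (hm.pow_const _).aestronglyMeasurable,
    hlayer, intervalIntegral.integral_of_le hy, integral_eq_lintegral_of_nonneg_ae
      (by
        filter_upwards [ae_restrict_mem measurableSet_Ioc] with t ht
        have h1 : 0 ≤ y - t := sub_nonneg.2 ht.2
        have h2 : 0 < t := ht.1
        simp only [Pi.zero_apply]
        positivity)
      (Continuous.aestronglyMeasurable (by fun_prop))]
  congr 1
  rw [← Set.Ioc_union_Ioi_eq_Ioi hy, lintegral_union measurableSet_Ioi
    (Set.Ioc_disjoint_Ioi le_rfl)]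
  have htail : ∫⁻ t in Set.Ioi y, (volume.restrict (Set.Icc (0 : Fin k → ℝ) (fun _ => y)))
      {u | t ≤ ⨅ i, u i} * ENNReal.ofReal (((q : ℝ) + 1) * t ^ q) = 0 := by
    rw [setLIntegral_congr_fun (g := fun _ => 0) measurableSet_Ioi, lintegral_zero]
    intro t ht
    have h : y < t := ht
    simp only
    rw [restrict_Icc_pi_le_iInf y t (hy.trans h.le), ENNReal.ofReal_of_nonpos (by linarith),
      zero_pow (NeZero.ne k), zero_mul]
  rw [htail, add_zero]
  refine setLIntegral_congr_fun measurableSet_Ioc fun t ht => ?_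
  have h1 : 0 ≤ y - t := sub_nonneg.2 ht.2
  rw [restrict_Icc_pi_le_iInf y t ht.1.le, ← ENNReal.ofReal_pow h1,
    ← ENNReal.ofReal_mul (by positivity)]

lemma setIntegral_Icc_pi_iInf_pow {k : ℕ} [NeZero k] (p : ℕ) {y : ℝ} (hy : 0 ≤ y) :
    ∫ u in Set.Icc (0 : Fin k → ℝ) (fun _ => y), (⨅ i, u i) ^ p
      = y ^ (p + k) / ((p + k).choose k : ℝ) := by
  cases p with
  | zero => simp [Measure.real, Real.volume_Icc_pi, hy]
  | succ q =>
    rw [setIntegral_Icc_pi_iInf_pow_succ q hy]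
    have : ∀ t : ℝ, (y - t) ^ k * ((q + 1) * t ^ q) = (q + 1) * (t ^ q * (y - t) ^ k) :=
      fun t => by ring
    simp only [this]
    rw [intervalIntegral.integral_const_mul, integral_pow_mul_sub_pow,
      Nat.cast_choose ℝ (Nat.le_add_left k (q + 1)), Nat.add_sub_cancel,
      show q + 1 + k = q + k + 1 by ring, Nat.factorial_succ q]
    push_cast
    field_simp

/-- Cube integral of a power of the minimum coordinate: under the perfect predictor, the
winning-probability CDF of an admitted bidder is proportional to `F₁^{m−1}`. -/
theorem stmt_6 (m n : ℕ) (hn : 2 ≤ n) (hnm : n ≤ m) (y : ℝ) (hy : y ∈ Set.Icc (0:ℝ) 1) :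
    ∫ u in Set.Icc (0 : Fin (n - 1) → ℝ) (fun _ => y), (⨅ i, u i) ^ (m - n)
      = y ^ (m - 1) / ((m - 1).choose (n - 1) : ℝ) := by
  have : NeZero (n - 1) := ⟨by omega⟩
  rw [setIntegral_Icc_pi_iInf_pow (m - n) hy.1, show m - n + (n - 1) = m - 1 by omega]
end

section
/- For all integers 2 ≤ n ≤ m and all x ∈ [0,1]: ∫₀^x J(t,n,m) dt = x·J(x,n,m) − ((m−n)/m)·J(x,n,m+1). -/
/-- `J x k M = C(M−1,k−1)·(M−k)·∫₀^x t^{M−k−1}(1−t)^{k−1} dt` for `k < M`, and `J x M M = 1`. -/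
noncomputable def J (x : ℝ) (k M : ℕ) : ℝ :=
  if k < M then
    ((M - 1).choose (k - 1) : ℝ) * ((M - k : ℕ) : ℝ) *
      ∫ t in (0:ℝ)..x, t ^ (M - k - 1) * (1 - t) ^ (k - 1)
  else 1

theorem integral_primitive_eq {g : ℝ → ℝ} (hg : Continuous g) (x : ℝ) :
    ∫ t in (0:ℝ)..x, ∫ s in (0:ℝ)..t, g s
      = x * (∫ t in (0:ℝ)..x, g t) - ∫ t in (0:ℝ)..x, t * g t := by
  have h := intervalIntegral.integral_mul_deriv_eq_deriv_mul (a := 0) (b := x)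
    (u := fun t => ∫ s in (0:ℝ)..t, g s) (v := fun t => t) (u' := g) (v' := fun _ => 1)
    (fun t _ => hg.integral_hasStrictDerivAt 0 t |>.hasDerivAt) (fun t _ => hasDerivAt_id t)
    (hg.intervalIntegrable 0 x) intervalIntegrable_const
  simpa [mul_comm] using h

/-- Integral identity: `∫₀^x J(t,n,m) dt = x·J(x,n,m) − ((m−n)/m)·J(x,n,m+1)`. -/
theorem stmt_9 (m n : ℕ) (hn : 2 ≤ n) (hnm : n ≤ m) (x : ℝ) (hx : x ∈ Set.Icc (0:ℝ) 1) :
    ∫ t in (0:ℝ)..x, J t n m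
      = x * J x n m - (((m - n : ℕ) : ℝ) / (m : ℝ)) * J x n (m + 1) := by
  rcases hnm.eq_or_lt with rfl | hlt
  · simp [J]
  obtain ⟨k, rfl⟩ : ∃ k, n = k + 1 := ⟨n - 1, by omega⟩
  obtain ⟨d, rfl⟩ : ∃ d, m = k + d + 2 := ⟨m - k - 2, by omega⟩
  have h₁ : k + d + 2 - (k + 1) = d + 1 := by omega
  have h₂ : k + d + 2 + 1 - (k + 1) = d + 2 := by omega
  have hchoose : ((k + d + 1).choose k : ℝ) * (k + d + 2) = (k + d + 2).choose k * (d + 2) := by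
    have h := Nat.choose_mul_succ_eq (k + d + 1) k
    rw [show k + d + 1 + 1 - k = d + 2 by omega] at h
    exact_mod_cast h
  have hne : (k : ℝ) + d + 2 ≠ 0 := by positivity
  have hint : ∫ t in (0:ℝ)..x, t * (t ^ d * (1 - t) ^ k)
      = ∫ t in (0:ℝ)..x, t ^ (d + 1) * (1 - t) ^ k := by
    congr 1 with t
    ring
  simp only [J, if_pos hlt, if_pos (hlt.trans (Nat.lt_succ_self _)), h₁, h₂,
    Nat.add_sub_cancel, show k + d + 2 - 1 = k + d + 1 from rfl, show d + 2 - 1 = d + 1 from rfl,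
    intervalIntegral.integral_const_mul]
  rw [integral_primitive_eq (by fun_prop), hint]
  push_cast
  rw [← hchoose]
  field_simp
end

section
/- Let F:[0,1]→ℝ be continuous and strictly increasing with F(0) = 0 and F(1) = 1. For each integer n ≥ 2 define R(n) := (n−1)·∫₀¹ F(x)ⁿ dx − n·∫₀¹ F(x)^{n−1} dx + 1. Then for every integer n ≥ 2, R(n+1) − R(n) = n·∫₀¹ F(x)^{n−1}·(1−F(x))² dx > 0; hence R is strictly increasing in n. -/
/-- Expected revenue of an all-pay auction with `n` i.i.d. participants with valuation CDF `F`
(null-predictor case): `R(n) = (n−1)·∫₀¹ Fⁿ − n·∫₀¹ F^{n−1} + 1`. -/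
noncomputable def R (F : ℝ → ℝ) (n : ℕ) : ℝ :=
  ((n : ℝ) - 1) * (∫ x in (0:ℝ)..1, (F x) ^ n)
    - (n : ℝ) * (∫ x in (0:ℝ)..1, (F x) ^ (n - 1)) + 1

theorem intervalIntegrable_pow_of_continuousOn_Icc {F : ℝ → ℝ} {a b : ℝ} (hab : a ≤ b)
    (hF : ContinuousOn F (Set.Icc a b)) (k : ℕ) :
    IntervalIntegrable (fun x => F x ^ k) MeasureTheory.volume a b :=
  (hF.pow k).intervalIntegrable_of_Icc hab

theorem R_succ_sub_R {F : ℝ → ℝ} (hF : ContinuousOn F (Set.Icc 0 1)) {n : ℕ} (hn : 1 ≤ n) :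
    R F (n + 1) - R F n = (n : ℝ) * ∫ x in (0:ℝ)..1, (F x) ^ (n - 1) * (1 - F x) ^ 2 := by
  obtain ⟨m, rfl⟩ := Nat.exists_eq_add_of_le' hn
  have hi := intervalIntegrable_pow_of_continuousOn_Icc zero_le_one hF
  have hexp : ∫ x in (0:ℝ)..1, (F x) ^ m * (1 - F x) ^ 2 =
      (∫ x in (0:ℝ)..1, (F x) ^ m) - 2 * (∫ x in (0:ℝ)..1, (F x) ^ (m + 1))
        + ∫ x in (0:ℝ)..1, (F x) ^ (m + 2) := by
    rw [← intervalIntegral.integral_const_mul,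
      ← intervalIntegral.integral_sub (hi m) ((hi (m + 1)).const_mul 2),
      ← intervalIntegral.integral_add ((hi m).sub ((hi (m + 1)).const_mul 2)) (hi (m + 2))]
    congr 1
    ext x
    ring
  simp only [R, Nat.add_sub_cancel, hexp]
  push_cast
  ring

theorem integral_pow_mul_one_sub_sq_pos {F : ℝ → ℝ} (hF : ContinuousOn F (Set.Icc 0 1))
    (hmono : StrictMonoOn F (Set.Icc 0 1)) (h0 : F 0 = 0) (h1 : F 1 = 1) (k : ℕ) :
    0 < ∫ x in (0:ℝ)..1, (F x) ^ k * (1 - F x) ^ 2 := by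
  refine intervalIntegral.intervalIntegral_pos_of_pos_on
    (((hF.pow k).mul ((continuousOn_const.sub hF).pow 2)).intervalIntegrable_of_Icc zero_le_one)
    (fun x hx => ?_) zero_lt_one
  have hx' := Set.Ioo_subset_Icc_self hx
  have hpos : 0 < F x := h0 ▸ hmono (Set.left_mem_Icc.2 zero_le_one) hx' hx.1
  have hlt : F x < 1 := h1 ▸ hmono hx' (Set.right_mem_Icc.2 zero_le_one) hx.2
  have := sub_pos.2 hlt
  positivity

/-- Theorem 4(ii): under the null predictor, the all-pay revenue is strictly increasing in the
number of participants. -/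
theorem stmt_11 (F : ℝ → ℝ) (hF : ContinuousOn F (Set.Icc 0 1))
    (hmono : StrictMonoOn F (Set.Icc 0 1)) (h0 : F 0 = 0) (h1 : F 1 = 1) :
    (∀ n : ℕ, 2 ≤ n →
      R F (n + 1) - R F n = (n : ℝ) * (∫ x in (0:ℝ)..1, (F x) ^ (n - 1) * (1 - F x) ^ 2) ∧
      0 < (n : ℝ) * (∫ x in (0:ℝ)..1, (F x) ^ (n - 1) * (1 - F x) ^ 2)) ∧
    (∀ n n' : ℕ, 2 ≤ n → n < n' → R F n < R F n') := by
  have hstep : ∀ n : ℕ, 2 ≤ n →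
      R F (n + 1) - R F n = (n : ℝ) * (∫ x in (0:ℝ)..1, (F x) ^ (n - 1) * (1 - F x) ^ 2) ∧
      0 < (n : ℝ) * (∫ x in (0:ℝ)..1, (F x) ^ (n - 1) * (1 - F x) ^ 2) := fun n hn =>
    ⟨R_succ_sub_R hF (by lia), mul_pos (Nat.cast_pos.2 (by lia))
      (integral_pow_mul_one_sub_sq_pos hF hmono h0 h1 (n - 1))⟩
  refine ⟨hstep, fun n n' hn hlt => ?_⟩
  induction n', hlt using Nat.le_induction with
  | base => exact sub_pos.1 ((hstep n hn).1 ▸ (hstep n hn).2)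
  | succ k hk ih =>
    obtain ⟨heq, hpos⟩ := hstep k (by lia)
    linarith
end

section
/- Fix integers 2 ≤ n < m. For c > 0 and γ ∈ [0,1], define Φ_{γ,c}(v) := v / ( (1−γ)/C(m,n) + γ·(m−n)·∫₀^{v^c} u^{m−n−1}·(1−u)^{n−1} du ) for v ∈ [0,1], where C(a,b) denotes the binomial coefficient. (i) If Φ_{γ,c} is nondecreasing on [0,1] for some γ ∈ [0,1], then Φ_{γ',c} is nondecreasing on [0,1] for every γ' ∈ [0,γ]. (ii) If Φ_{γ,c} is nondecreasing on [0,1] for some c > 0, then Φ_{γ,c'} is nondecreasing on [0,1] for every c' ∈ (0,c]. -/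
/-- The inflated type `Φ_{γ,c}(v) = κ(v;n,HP(γ))·v` for the hallucinatory predictor with
accuracy `γ` and power-law prior `F₁(x) = x^c`. -/
noncomputable def Phi (m n : ℕ) (γ c : ℝ) (v : ℝ) : ℝ :=
  v / ((1 - γ) / (m.choose n : ℝ)
    + γ * ((m - n : ℕ) : ℝ) * ∫ u in (0:ℝ)..(v ^ c), u ^ (m - n - 1) * (1 - u) ^ (n - 1))

theorem incompleteBeta_nonneg (p q : ℕ) {t : ℝ} (ht0 : 0 ≤ t) (ht1 : t ≤ 1) :
    0 ≤ ∫ u in (0:ℝ)..t, u ^ p * (1 - u) ^ q :=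
  intervalIntegral.integral_nonneg ht0 fun u hu =>
    mul_nonneg (pow_nonneg hu.1 _) (pow_nonneg (by linarith [hu.2]) _)

theorem incompleteBeta_pos (p q : ℕ) {t : ℝ} (ht0 : 0 < t) (ht1 : t ≤ 1) :
    0 < ∫ u in (0:ℝ)..t, u ^ p * (1 - u) ^ q :=
  intervalIntegral.intervalIntegral_pos_of_pos_on
    (Continuous.intervalIntegrable (by fun_prop) _ _)
    (fun u hu => mul_pos (pow_pos hu.1 _) (pow_pos (by linarith [hu.2]) _)) ht0

theorem Phi_nonneg {m n : ℕ} {γ c v : ℝ} (hc : 0 < c) (hγ : γ ∈ Set.Icc (0:ℝ) 1)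
    (hv : v ∈ Set.Icc (0:ℝ) 1) : 0 ≤ Phi m n γ c v := by
  have hI := incompleteBeta_nonneg (m - n - 1) (n - 1) (Real.rpow_nonneg hv.1 c)
    (Real.rpow_le_one hv.1 hv.2 hc.le)
  have h1 : 0 ≤ 1 - γ := sub_nonneg.2 hγ.2
  have h2 := hγ.1
  have h3 := hv.1
  unfold Phi
  positivity

theorem Phi_denom_pos {m n : ℕ} (hnm : n < m) {γ c v : ℝ} (hc : 0 < c)
    (hγ : γ ∈ Set.Icc (0:ℝ) 1) (hv0 : 0 < v) (hv1 : v ≤ 1) :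
    0 < (1 - γ) / (m.choose n : ℝ)
      + γ * ((m - n : ℕ) : ℝ) * ∫ u in (0:ℝ)..(v ^ c), u ^ (m - n - 1) * (1 - u) ^ (n - 1) := by
  have hI := incompleteBeta_pos (m - n - 1) (n - 1) (Real.rpow_pos_of_pos hv0 c)
    (Real.rpow_le_one hv0.le hv1 hc.le)
  have hC : (0:ℝ) < m.choose n := by exact_mod_cast Nat.choose_pos hnm.le
  have hk : (0:ℝ) < (m - n : ℕ) := by exact_mod_cast Nat.sub_pos_of_lt hnm
  have h1 : 0 ≤ 1 - γ := sub_nonneg.2 hγ.2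
  rcases hγ.1.eq_or_lt with h | h
  · subst h
    simpa using hC
  · positivity

theorem Phi_zero (m n : ℕ) (γ c : ℝ) : Phi m n γ c 0 = 0 := by
  simp [Phi]

theorem Phi_monotoneOn_of_accuracy_le {m n : ℕ} (hnm : n < m) {γ γ' c : ℝ} (hc : 0 < c)
    (hγ : γ ∈ Set.Icc (0:ℝ) 1) (hγ'0 : 0 ≤ γ') (hle : γ' ≤ γ)
    (hmono : MonotoneOn (Phi m n γ c) (Set.Icc 0 1)) :
    MonotoneOn (Phi m n γ' c) (Set.Icc 0 1) := by
  have hγ' : γ' ∈ Set.Icc (0:ℝ) 1 := ⟨hγ'0, hle.trans hγ.2⟩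
  intro x hx y hy hxy
  rcases hx.1.eq_or_lt with h0 | hx0
  · rw [← h0, Phi_zero]
    exact Phi_nonneg hc hγ' hy
  have hy0 := hx0.trans_le hxy
  have h := hmono hx hy hxy
  unfold Phi at h ⊢
  rw [div_le_div_iff₀ (Phi_denom_pos hnm hc hγ hx0 hx.2)
    (Phi_denom_pos hnm hc hγ hy0 hy.2)] at h
  rw [div_le_div_iff₀ (Phi_denom_pos hnm hc hγ' hx0 hx.2)
    (Phi_denom_pos hnm hc hγ' hy0 hy.2)]
  generalize (∫ u in (0:ℝ)..(x ^ c), u ^ (m - n - 1) * (1 - u) ^ (n - 1)) = I at h ⊢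
  generalize (∫ u in (0:ℝ)..(y ^ c), u ^ (m - n - 1) * (1 - u) ^ (n - 1)) = J at h ⊢
  have hk : (0:ℝ) ≤ (m - n : ℕ) := Nat.cast_nonneg _
  generalize ((m - n : ℕ) : ℝ) = k at h hk ⊢
  have hC : (0:ℝ) ≤ (m.choose n : ℝ)⁻¹ := by positivity
  simp only [div_eq_mul_inv] at h ⊢
  generalize (m.choose n : ℝ)⁻¹ = a at h hC ⊢
  have hγ1 := hγ'.2
  have hA : 0 ≤ a * (y - x) := mul_nonneg hC (sub_nonneg.2 hxy)
  rcases le_total 0 (k * (y * I - x * J)) with hs | hs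
  · nlinarith [mul_nonneg (sub_nonneg.2 hγ1) hA, mul_nonneg hγ'0 hs]
  · nlinarith [mul_nonneg (sub_nonneg.2 hle) hA,
      mul_nonneg (sub_nonneg.2 hle) (neg_nonneg.2 hs)]

theorem Phi_eq_rpow_mul_Phi {m n : ℕ} {γ c c' v : ℝ} (hc' : 0 < c') (hle : c' ≤ c)
    (hv : 0 ≤ v) :
    Phi m n γ c' v = v ^ (1 - c' / c) * Phi m n γ c (v ^ (c' / c)) := by
  have hc : 0 < c := hc'.trans_le hle
  have h1 : 0 ≤ 1 - c' / c := sub_nonneg.2 ((div_le_one hc).2 hle)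
  have hpow : (v ^ (c' / c)) ^ c = v ^ c' := by
    rw [← Real.rpow_mul hv, div_mul_cancel₀ _ hc.ne']
  have hprod : v ^ (1 - c' / c) * v ^ (c' / c) = v := by
    rw [← Real.rpow_add_of_nonneg hv h1 (by positivity), sub_add_cancel, Real.rpow_one]
  unfold Phi
  rw [hpow, ← mul_div_assoc, hprod]

theorem Phi_monotoneOn_of_exponent_le {m n : ℕ} {γ c c' : ℝ} (hγ : γ ∈ Set.Icc (0:ℝ) 1)
    (hc' : 0 < c') (hle : c' ≤ c) (hmono : MonotoneOn (Phi m n γ c) (Set.Icc 0 1)) :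
    MonotoneOn (Phi m n γ c') (Set.Icc 0 1) := by
  have hc : 0 < c := hc'.trans_le hle
  have hr : 0 ≤ c' / c := by positivity
  have h1 : 0 ≤ 1 - c' / c := sub_nonneg.2 ((div_le_one hc).2 hle)
  have hmem : ∀ v ∈ Set.Icc (0:ℝ) 1, v ^ (c' / c) ∈ Set.Icc (0:ℝ) 1 := fun v hv =>
    ⟨Real.rpow_nonneg hv.1 _, Real.rpow_le_one hv.1 hv.2 hr⟩
  intro x hx y hy hxy
  rw [Phi_eq_rpow_mul_Phi hc' hle hx.1, Phi_eq_rpow_mul_Phi hc' hle hy.1]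
  exact mul_le_mul (Real.rpow_le_rpow hx.1 hxy h1)
    (hmono (hmem x hx) (hmem y hy) (Real.rpow_le_rpow hx.1 hxy hr))
    (Phi_nonneg hc hγ (hmem x hx)) (Real.rpow_nonneg hy.1 _)


/-- Proposition 5: the inflated-type monotonicity condition is preserved when the prediction
accuracy `γ` decreases, and when the prior exponent `c` decreases. -/
theorem stmt_12 (m n : ℕ) (hn : 2 ≤ n) (hnm : n < m) (c : ℝ) (hc : 0 < c)
    (γ : ℝ) (hγ : γ ∈ Set.Icc (0:ℝ) 1) :
    (MonotoneOn (Phi m n γ c) (Set.Icc 0 1) →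
      ∀ γ' : ℝ, 0 ≤ γ' → γ' ≤ γ → MonotoneOn (Phi m n γ' c) (Set.Icc 0 1)) ∧
    (MonotoneOn (Phi m n γ c) (Set.Icc 0 1) →
      ∀ c' : ℝ, 0 < c' → c' ≤ c → MonotoneOn (Phi m n γ c') (Set.Icc 0 1)) :=
  ⟨fun h _ h0 hle => Phi_monotoneOn_of_accuracy_le hnm hc hγ h0 hle h,
    fun h _ h0 hle => Phi_monotoneOn_of_exponent_le hγ h0 hle h⟩
end

section
/- Let C:[0,1]²→ℝ be twice continuously differentiable and satisfy: C(x,1) = x and C(1,y) = y for all x,y ∈ [0,1]; 0 ≤ ∂₁C(x,y) ≤ 1; ∂₂C(x,y) ≥ 0; ∂₁∂₂C(x,y) ≥ 0; and x·∂₁C(x,y) + y·∂₂C(x,y) − C(x,y) ≥ 0 for all x,y ∈ [0,1]. Then for all integers 2 ≤ n < m and all a ∈ [0,1]: (m−1)·∫₀¹ (a−C(a,t))^{n−1}·(1−∂₁C(a,t))·t^{m−n−1} dt ≥ (n−1)·a·∫₀¹ (a−C(a,t))^{n−2}·(1−∂₁C(a,t))²·t^{m−n−1} dt. -/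
section MixedPartials

variable {C : ℝ → ℝ → ℝ}

lemma hasDerivAt_partial_fst (hC : Differentiable ℝ (fun p : ℝ × ℝ => C p.1 p.2)) (x y : ℝ) :
    HasDerivAt (fun s => C s y) (fderiv ℝ (fun p : ℝ × ℝ => C p.1 p.2) (x, y) (1, 0)) x :=
  (hC (x, y)).hasFDerivAt.comp_hasDerivAt (f := fun s : ℝ => (s, y)) x
    ((hasDerivAt_id x).prodMk (hasDerivAt_const x y))

lemma hasDerivAt_partial_snd (hC : Differentiable ℝ (fun p : ℝ × ℝ => C p.1 p.2)) (x y : ℝ) :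
    HasDerivAt (fun t => C x t) (fderiv ℝ (fun p : ℝ × ℝ => C p.1 p.2) (x, y) (0, 1)) y :=
  (hC (x, y)).hasFDerivAt.comp_hasDerivAt (f := fun t : ℝ => (x, t)) y
    ((hasDerivAt_const y x).prodMk (hasDerivAt_id y))

lemma contDiff_partial_fst (hC : ContDiff ℝ 2 (fun p : ℝ × ℝ => C p.1 p.2)) :
    ContDiff ℝ 1 (fun p : ℝ × ℝ => deriv (fun s => C s p.2) p.1) := by
  have h : (fun p : ℝ × ℝ => deriv (fun s => C s p.2) p.1)
      = fun p => fderiv ℝ (fun p : ℝ × ℝ => C p.1 p.2) p (1, 0) :=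
    funext fun p => (hasDerivAt_partial_fst (hC.differentiable (by norm_num)) p.1 p.2).deriv
  rw [h]
  exact (hC.fderiv_right (m := 1) (by norm_num)).clm_apply contDiff_const

/-- Symmetry of the mixed partial derivatives of a `C²` function of two real variables. -/
lemma deriv_partial_comm (hC : ContDiff ℝ 2 (fun p : ℝ × ℝ => C p.1 p.2)) (x y : ℝ) :
    deriv (fun t => deriv (fun s => C s t) x) y = deriv (fun s => deriv (fun t => C s t) y) x := by
  have hd : Differentiable ℝ (fun p : ℝ × ℝ => C p.1 p.2) := hC.differentiable (by norm_num)
  have hd2 : Differentiable ℝ (fderiv ℝ (fun p : ℝ × ℝ => C p.1 p.2)) :=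
    (hC.fderiv_right (m := 1) (by norm_num)).differentiable (by norm_num)
  have hfst : HasDerivAt (fun t => fderiv ℝ (fun p : ℝ × ℝ => C p.1 p.2) (x, t) (1, 0))
      (fderiv ℝ (fderiv ℝ (fun p : ℝ × ℝ => C p.1 p.2)) (x, y) (0, 1) (1, 0)) y := by
    have h := (hd2 (x, y)).hasFDerivAt.comp_hasDerivAt (f := fun t : ℝ => (x, t)) y
      ((hasDerivAt_const y x).prodMk (hasDerivAt_id y))
    simpa using h.clm_apply (hasDerivAt_const y ((1, 0) : ℝ × ℝ))
  have hsnd : HasDerivAt (fun s => fderiv ℝ (fun p : ℝ × ℝ => C p.1 p.2) (s, y) (0, 1))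
      (fderiv ℝ (fderiv ℝ (fun p : ℝ × ℝ => C p.1 p.2)) (x, y) (1, 0) (0, 1)) x := by
    have h := (hd2 (x, y)).hasFDerivAt.comp_hasDerivAt (f := fun s : ℝ => (s, y)) x
      ((hasDerivAt_id x).prodMk (hasDerivAt_const x y))
    simpa using h.clm_apply (hasDerivAt_const x ((0, 1) : ℝ × ℝ))
  simp_rw [(hasDerivAt_partial_fst hd _ _).deriv, (hasDerivAt_partial_snd hd _ _).deriv]
  rw [hfst.deriv, hsnd.deriv]
  exact hC.contDiffAt.isSymmSndFDerivAt (by simp) _ _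

end MixedPartials

/-- If `u` and `w` are nonnegative on `[0, 1]`, `w` is decreasing, `u 1 = 0` and
`a * w ≤ u - t * u'`, then integrating the derivative of `u ^ (j + 1) * w * t ^ (k + 1)`
compares the two weighted integrals. -/
lemma weighted_integral_le {u w : ℝ → ℝ} (hu : ContDiff ℝ 1 u) (hw : ContDiff ℝ 1 w)
    (hu0 : ∀ t ∈ Set.Icc (0 : ℝ) 1, 0 ≤ u t) (hw0 : ∀ t ∈ Set.Icc (0 : ℝ) 1, 0 ≤ w t)
    (hw' : ∀ t ∈ Set.Icc (0 : ℝ) 1, deriv w t ≤ 0) (hu1 : u 1 = 0) {a : ℝ}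
    (huw : ∀ t ∈ Set.Icc (0 : ℝ) 1, a * w t ≤ u t - t * deriv u t) (j k : ℕ) :
    ((j : ℝ) + 1) * a * (∫ t in (0 : ℝ)..1, u t ^ j * w t ^ 2 * t ^ k)
      ≤ ((j : ℝ) + k + 2) * (∫ t in (0 : ℝ)..1, u t ^ (j + 1) * w t * t ^ k) := by
  have cu := hu.continuous
  have cw := hw.continuous
  have cu' : Continuous (deriv u) := hu.continuous_deriv (by norm_num)
  have cw' : Continuous (deriv w) := hw.continuous_deriv (by norm_num)
  set g : ℝ → ℝ := fun t => ((j + 1) * u t ^ j * deriv u t * w t + u t ^ (j + 1) * deriv w t)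
    * t ^ (k + 1) + u t ^ (j + 1) * w t * ((k + 1) * t ^ k) with hg
  have cg : Continuous g := by fun_prop
  have hderiv : ∀ t, HasDerivAt (fun t => u t ^ (j + 1) * w t * t ^ (k + 1)) (g t) t := by
    intro t
    have h := ((((hu.differentiable (by norm_num) t).hasDerivAt).fun_pow (j + 1)).fun_mul
      (hw.differentiable (by norm_num) t).hasDerivAt).fun_mul (hasDerivAt_pow (k + 1) t)
    simpa [hg] using h
  have hint : ∫ t in (0 : ℝ)..1, g t = 0 := by
    rw [intervalIntegral.integral_eq_sub_of_hasDerivAt (fun t _ => hderiv t)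
      (cg.intervalIntegrable _ _)]
    simp [hu1]
  have hle : (∫ t in (0 : ℝ)..1, (((j : ℝ) + 1) * a * (u t ^ j * w t ^ 2 * t ^ k) + g t))
      ≤ ∫ t in (0 : ℝ)..1, ((j : ℝ) + k + 2) * (u t ^ (j + 1) * w t * t ^ k) := by
    refine intervalIntegral.integral_mono_on zero_le_one
      (Continuous.intervalIntegrable (by fun_prop) _ _)
      (Continuous.intervalIntegrable (by fun_prop) _ _) fun t ht => ?_
    have e1 : 0 ≤ ((j : ℝ) + 1) * (u t ^ j * w t * t ^ k) * (u t - t * deriv u t - a * w t) := by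
      have := hu0 t ht
      have := hw0 t ht
      have := ht.1
      exact mul_nonneg (by positivity) (sub_nonneg.2 (huw t ht))
    have e2 : 0 ≤ u t ^ (j + 1) * t ^ (k + 1) * (-deriv w t) := by
      have := hu0 t ht
      have := ht.1
      exact mul_nonneg (by positivity) (neg_nonneg.2 (hw' t ht))
    simp only [hg]
    linear_combination e1 + e2
  rw [intervalIntegral.integral_add (Continuous.intervalIntegrable (by fun_prop) _ _)
    (cg.intervalIntegrable _ _), hint, add_zero, intervalIntegral.integral_const_mul,
    intervalIntegral.integral_const_mul] at hle
  exact hle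

/-- Proposition 2 (main implication): for a copula `C` satisfying the boundary, monotonicity,
and condition (13) hypotheses, the reverse-hazard-rate bound
`RHR(x;n,F) ≤ (m−1)·f₁(x)/F₁(x)` holds; in integral form with `a = F₁(x)`. -/
theorem stmt_13 (C : ℝ → ℝ → ℝ)
    (hC : ContDiff ℝ 2 (fun p : ℝ × ℝ => C p.1 p.2))
    (hb1 : ∀ x ∈ Set.Icc (0:ℝ) 1, C x 1 = x)
    (hb2 : ∀ y ∈ Set.Icc (0:ℝ) 1, C 1 y = y)
    (h1 : ∀ x ∈ Set.Icc (0:ℝ) 1, ∀ y ∈ Set.Icc (0:ℝ) 1,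
      deriv (fun s => C s y) x ∈ Set.Icc (0:ℝ) 1)
    (h2 : ∀ x ∈ Set.Icc (0:ℝ) 1, ∀ y ∈ Set.Icc (0:ℝ) 1, 0 ≤ deriv (fun t => C x t) y)
    (h12 : ∀ x ∈ Set.Icc (0:ℝ) 1, ∀ y ∈ Set.Icc (0:ℝ) 1,
      0 ≤ deriv (fun s => deriv (fun t => C s t) y) x)
    (hcond : ∀ x ∈ Set.Icc (0:ℝ) 1, ∀ y ∈ Set.Icc (0:ℝ) 1,
      0 ≤ x * deriv (fun s => C s y) x + y * deriv (fun t => C x t) y - C x y)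
    (m n : ℕ) (hn : 2 ≤ n) (hnm : n < m) (a : ℝ) (ha : a ∈ Set.Icc (0:ℝ) 1) :
    ((n : ℝ) - 1) * a * (∫ t in (0:ℝ)..1,
        (a - C a t) ^ (n - 2) * (1 - deriv (fun s => C s t) a) ^ 2 * t ^ (m - n - 1))
      ≤ ((m : ℝ) - 1) * (∫ t in (0:ℝ)..1,
        (a - C a t) ^ (n - 1) * (1 - deriv (fun s => C s t) a) * t ^ (m - n - 1)) := by
  have hC1 := contDiff_partial_fst hC
  have hu : ContDiff ℝ 1 (fun t => a - C a t) :=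
    contDiff_const.sub ((hC.of_le (by norm_num)).comp (contDiff_const.prodMk contDiff_id))
  have hw : ContDiff ℝ 1 (fun t => 1 - deriv (fun s => C s t) a) :=
    contDiff_const.sub (hC1.comp (contDiff_const.prodMk contDiff_id))
  have hdu : ∀ t, deriv (fun t => a - C a t) t = -deriv (fun t => C a t) t := fun t => by simp
  have hu1 : a - C a 1 = 0 := by rw [hb1 a ha, sub_self]
  have hanti : AntitoneOn (fun t => a - C a t) (Set.Icc 0 1) := by
    refine antitoneOn_of_deriv_nonpos (convex_Icc 0 1) hu.continuous.continuousOn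
      (hu.differentiable (by norm_num)).differentiableOn fun t ht => ?_
    rw [hdu]
    exact neg_nonpos.2 (h2 a ha t (interior_subset ht))
  have key := weighted_integral_le hu hw (a := a)
    (fun t ht => hu1.symm.trans_le (hanti ht (Set.right_mem_Icc.2 zero_le_one) ht.2))
    (fun t ht => sub_nonneg.2 (h1 a ha t ht).2)
    (fun t ht => by
      have hs : deriv (fun t => 1 - deriv (fun s => C s t) a) t
          = -deriv (fun t => deriv (fun s => C s t) a) t := by simp
      rw [hs, deriv_partial_comm hC]
      exact neg_nonpos.2 (h12 a ha t ht))
    hu1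
    (fun t ht => by
      rw [hdu]
      linarith [hcond a ha t ht])
    (n - 2) (m - n - 1)
  have hj : ((n - 2 : ℕ) : ℝ) = n - 2 := by push_cast [hn]; ring
  have hk : ((m - n - 1 : ℕ) : ℝ) = m - n - 1 := by
    rw [Nat.sub_sub, Nat.cast_sub hnm]; push_cast; ring
  rw [hj, hk, show n - 2 + 1 = n - 1 by omega] at key
  convert key using 2 <;> ring
end

section
/- For all x, y ∈ [0,1] and α ∈ [0,1]: (i) for the AMH copula C(x,y) = xy/D with D = 1−α(1−x)(1−y), whenever D > 0 one has x·∂ₓC(x,y) + y·∂ᵧC(x,y) − C(x,y) = xy·(1+α(xy−1))/D² ≥ 0; (ii) for the FGM copula C(x,y) = xy·(1+α(1−x)(1−y)), one has x·∂ₓC(x,y) + y·∂ᵧC(x,y) − C(x,y) = xy·(1+α(3xy−2x−2y+1)) ≥ 0. -/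
theorem hasDerivAt_amh_copula (α x y : ℝ) (hD : 1 - α * (1 - x) * (1 - y) ≠ 0) :
    HasDerivAt (fun s => s * y / (1 - α * (1 - s) * (1 - y)))
      ((y * (1 - α * (1 - x) * (1 - y)) - x * y * (α * (1 - y)))
        / (1 - α * (1 - x) * (1 - y)) ^ 2) x := by
  have hnum : HasDerivAt (fun s : ℝ => s * y) y x := by
    simpa using (hasDerivAt_id x).mul_const y
  have hden : HasDerivAt (fun s : ℝ => 1 - α * (1 - s) * (1 - y)) (α * (1 - y)) x := by
    simpa using ((((hasDerivAt_id x).const_sub 1).const_mul α).mul_const (1 - y)).const_sub 1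
  exact hnum.fun_div hden hD

theorem hasDerivAt_fgm_copula (α x y : ℝ) :
    HasDerivAt (fun s => s * y * (1 + α * (1 - s) * (1 - y)))
      (y * (1 + α * (1 - x) * (1 - y)) - x * y * (α * (1 - y))) x := by
  have hlin : HasDerivAt (fun s : ℝ => s * y) y x := by
    simpa using (hasDerivAt_id x).mul_const y
  have hfac : HasDerivAt (fun s : ℝ => 1 + α * (1 - s) * (1 - y)) (-(α * (1 - y))) x := by
    simpa using ((((hasDerivAt_id x).const_sub 1).const_mul α).mul_const (1 - y)).const_add 1
  exact (hlin.fun_mul hfac).congr_deriv (by ring)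

/-- Proposition 2(i): the AMH and FGM copulas with parameter `α ∈ [0,1]` satisfy condition (13)
of the paper, with the stated closed forms for `x·∂ₓC + y·∂ᵧC − C`. -/
theorem stmt_14 (x y α : ℝ) (hx : x ∈ Set.Icc (0:ℝ) 1) (hy : y ∈ Set.Icc (0:ℝ) 1)
    (hα : α ∈ Set.Icc (0:ℝ) 1) :
    (0 < 1 - α * (1 - x) * (1 - y) →
      (x * deriv (fun s => s * y / (1 - α * (1 - s) * (1 - y))) x
        + y * deriv (fun t => x * t / (1 - α * (1 - x) * (1 - t))) y
        - x * y / (1 - α * (1 - x) * (1 - y))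
        = x * y * (1 + α * (x * y - 1)) / (1 - α * (1 - x) * (1 - y)) ^ 2 ∧
       0 ≤ x * y * (1 + α * (x * y - 1)) / (1 - α * (1 - x) * (1 - y)) ^ 2)) ∧
    (x * deriv (fun s => s * y * (1 + α * (1 - s) * (1 - y))) x
      + y * deriv (fun t => x * t * (1 + α * (1 - x) * (1 - t))) y
      - x * y * (1 + α * (1 - x) * (1 - y))
      = x * y * (1 + α * (3 * x * y - 2 * x - 2 * y + 1)) ∧
     0 ≤ x * y * (1 + α * (3 * x * y - 2 * x - 2 * y + 1))) := by
  obtain ⟨hx0, hx1⟩ := hx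
  obtain ⟨hy0, hy1⟩ := hy
  obtain ⟨hα0, hα1⟩ := hα
  have hxy : 0 ≤ x * y := mul_nonneg hx0 hy0
  refine ⟨fun hD => ⟨?_, ?_⟩, ?_, ?_⟩
  · have hswap : (fun t => x * t / (1 - α * (1 - x) * (1 - t)))
        = fun t => t * x / (1 - α * (1 - t) * (1 - x)) := by
      funext t
      rw [mul_comm x t, mul_right_comm α]
    have hD' : 1 - α * (1 - y) * (1 - x) = 1 - α * (1 - x) * (1 - y) := by ring
    rw [hswap, (hasDerivAt_amh_copula α x y hD.ne').deriv,
      (hasDerivAt_amh_copula α y x (hD'.trans_ne hD.ne')).deriv, hD']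
    have hne := hD.ne'
    field_simp
    ring
  · have hfac : 0 ≤ 1 + α * (x * y - 1) := by nlinarith [mul_nonneg hα0 hxy]
    positivity
  · have hswap : (fun t => x * t * (1 + α * (1 - x) * (1 - t)))
        = fun t => t * x * (1 + α * (1 - t) * (1 - x)) := by
      funext t
      rw [mul_comm x t, mul_right_comm α]
    rw [hswap, (hasDerivAt_fgm_copula α x y).deriv, (hasDerivAt_fgm_copula α y x).deriv]
    ring
  · have hcorner : 0 ≤ (1 - x) * (1 - y) := mul_nonneg (sub_nonneg.2 hx1) (sub_nonneg.2 hy1)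
    refine mul_nonneg hxy ?_
    nlinarith [mul_nonneg hα0 hxy, mul_nonneg hα0 hcorner]
end

section
/- For all x, γ ∈ [0,1]: 4γ²(1−γ)x³ − 5γ(1−γ)(2γ+1)x² − (8γ³ − 11γ² − 26γ + 20)x + (2γ³ − 16γ² − 3γ + 25) > 0. -/
/-- Polynomial positivity from Example 2: the hallucinatory predictor has a reverse hazard rate
at least as high as the FGM predictor with the same parameter (m = 3, n = 2). -/
theorem stmt_15 (x γ : ℝ) (hx : x ∈ Set.Icc (0:ℝ) 1) (hγ : γ ∈ Set.Icc (0:ℝ) 1) :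
    0 < 4 * γ ^ 2 * (1 - γ) * x ^ 3 - 5 * γ * (1 - γ) * (2 * γ + 1) * x ^ 2
      - (8 * γ ^ 3 - 11 * γ ^ 2 - 26 * γ + 20) * x + (2 * γ ^ 3 - 16 * γ ^ 2 - 3 * γ + 25) := by
  obtain ⟨hx0, hx1⟩ := hx
  obtain ⟨hγ0, hγ1⟩ := hγ
  have hx1' : 0 ≤ 1 - x := sub_nonneg.2 hx1
  have hγ1' : 0 ≤ 1 - γ := sub_nonneg.2 hγ1
  have value_zero : 5 ≤ 25 - 3 * γ - 16 * γ ^ 2 + 2 * γ ^ 3 := by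
    have : 0 ≤ γ ^ 3 := by positivity
    nlinarith
  have value_one : 5 ≤ 5 + 18 * γ - 6 * γ ^ 2 := by nlinarith
  have excess : 0 ≤ x * (1 - x) * (γ * (1 - γ)) * (5 + 2 * γ + 4 * γ * (1 - x)) := by
    positivity
  -- Compare the cubic in `x` with its linear interpolation between `x = 0` and `x = 1`.
  linear_combination excess + x * value_one + (1 - x) * value_zero
end

section
/- For all x, γ ∈ [0,1]: (3x³ − 8x² + 9x − 3)·γ² + 4x²·γ + (3 − 2x²) ≥ 0. -/
/-- Polynomial inequality from Example 2: the reverse hazard rate under the hallucinatory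
predictor (m = 3, n = 2) is nondecreasing in the prediction-accuracy parameter `γ`. -/
theorem stmt_16 (x γ : ℝ) (hx : x ∈ Set.Icc (0:ℝ) 1) (hγ : γ ∈ Set.Icc (0:ℝ) 1) :
    0 ≤ (3 * x ^ 3 - 8 * x ^ 2 + 9 * x - 3) * γ ^ 2 + 4 * x ^ 2 * γ + (3 - 2 * x ^ 2) := by
  obtain ⟨hx0, hx1⟩ := hx
  obtain ⟨hγ0, hγ1⟩ := hγ
  have hγsq : γ ^ 2 ≤ γ := by nlinarith
  have hlin : 0 ≤ 4 * x ^ 2 * (γ - γ ^ 2) := mul_nonneg (by positivity) (by linarith)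
  have hconst : 0 ≤ (3 - 2 * x ^ 2) * (1 - γ ^ 2) :=
    mul_nonneg (by nlinarith) (by linarith)
  have hlead : 0 ≤ γ ^ 2 * (x * (3 * (x - 1) ^ 2 + 6)) := by positivity
  linarith
end

section
/- For c > 0 and integer n ≥ 2 define HB(n,c) := n(n−1)c² / ( ((2n−1)c+1)·((n−1)c+1) ). Then: (i) (n−1)c·∫₀¹ x^{(n−1)c}·(1 − x^{nc}) dx = HB(n,c); (ii) for every integer n ≥ 2, HB(n+1,c) ≥ HB(n,c) if and only if (3c−c²)·n + c² − c + 2 ≥ 0; (iii) if 0 < c ≤ 3, then HB(·,c) is nondecreasing on integers n ≥ 2; (iv) if c ≥ (5+√33)/2, then HB(·,c) is nonincreasing on integers n ≥ 2. -/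
/-- Expected highest bid in a symmetric all-pay auction with `n` participants and power-law
prior `F(x) = x^c`: `HB(n,c) = n(n−1)c² / (((2n−1)c+1)((n−1)c+1))`. -/
noncomputable def HB (n : ℕ) (c : ℝ) : ℝ :=
  (n : ℝ) * ((n : ℝ) - 1) * c ^ 2 /
    (((2 * (n : ℝ) - 1) * c + 1) * (((n : ℝ) - 1) * c + 1))

theorem HB_integral (n c : ℝ) (hc : 0 < c) (hn : 1 ≤ n) :
    (n - 1) * c * (∫ x in (0:ℝ)..1, x ^ ((n - 1) * c) * (1 - x ^ (n * c)))
      = n * (n - 1) * c ^ 2 / (((2 * n - 1) * c + 1) * ((n - 1) * c + 1)) := by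
  have ha : 0 ≤ (n - 1) * c := mul_nonneg (by linarith) hc.le
  have hb : 0 ≤ n * c := mul_nonneg (by linarith) hc.le
  have hs : ∫ x in (0:ℝ)..1, x ^ ((n - 1) * c) * (1 - x ^ (n * c))
      = ∫ x in (0:ℝ)..1, (x ^ ((n - 1) * c) - x ^ ((n - 1) * c + n * c)) := by
    refine intervalIntegral.integral_congr fun x hx => ?_
    rw [Set.uIcc_of_le zero_le_one] at hx
    simp only [Real.rpow_add_of_nonneg hx.1 ha hb]
    ring
  have h₁ : (n - 1) * c + 1 ≠ 0 := by positivity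
  have h₂ : (n - 1) * c + n * c + 1 ≠ 0 := by positivity
  have h₃ : (2 * n - 1) * c + 1 = (n - 1) * c + n * c + 1 := by ring
  rw [hs, intervalIntegral.integral_sub
      (intervalIntegral.intervalIntegrable_rpow' (by linarith))
      (intervalIntegral.intervalIntegrable_rpow' (by linarith)),
    integral_rpow (Or.inl (by linarith)), integral_rpow (Or.inl (by linarith)), h₃,
    Real.one_rpow, Real.one_rpow, Real.zero_rpow h₁, Real.zero_rpow h₂,
    div_sub_div _ _ h₁ h₂, ← mul_div_assoc,
    div_eq_div_iff (mul_ne_zero h₁ h₂) (mul_ne_zero h₂ h₁)]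
  ring

/-- The sign of `HB (n + 1) c - HB n c` is that of an affine function of `n`. -/
theorem HB_succ_sub (c : ℝ) (hc : 0 < c) (n : ℕ) (hn : 2 ≤ n) :
    ∃ k : ℝ, 0 < k ∧
      HB (n + 1) c - HB n c = k * ((3 * c - c ^ 2) * (n : ℝ) + c ^ 2 - c + 2) := by
  have hn' : (2 : ℝ) ≤ n := by exact_mod_cast hn
  have h₁ : 0 < (2 * (n : ℝ) - 1) * c + 1 := by
    have := mul_pos (show 0 < 2 * (n : ℝ) - 1 by linarith) hc
    linarith
  have h₂ : 0 < ((n : ℝ) - 1) * c + 1 := by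
    have := mul_pos (show 0 < (n : ℝ) - 1 by linarith) hc
    linarith
  have h₃ : 0 < (2 * (n : ℝ) + 1) * c + 1 := by positivity
  have h₄ : 0 < (n : ℝ) * c + 1 := by positivity
  refine ⟨n * c ^ 2 / (((2 * (n : ℝ) + 1) * c + 1) * ((n : ℝ) * c + 1) *
    (((2 * (n : ℝ) - 1) * c + 1) * (((n : ℝ) - 1) * c + 1))), by positivity, ?_⟩
  have e₁ : (2 * ((n : ℝ) + 1) - 1) * c + 1 = (2 * (n : ℝ) + 1) * c + 1 := by ring
  have e₂ : ((n : ℝ) + 1 - 1) * c + 1 = (n : ℝ) * c + 1 := by ring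
  unfold HB
  push_cast
  rw [e₁, e₂, div_sub_div _ _ (by positivity) (by positivity), div_mul_eq_mul_div]
  congr 1
  ring

theorem HB_le_succ_iff (c : ℝ) (hc : 0 < c) (n : ℕ) (hn : 2 ≤ n) :
    HB n c ≤ HB (n + 1) c ↔ 0 ≤ (3 * c - c ^ 2) * (n : ℝ) + c ^ 2 - c + 2 := by
  obtain ⟨k, hk, h⟩ := HB_succ_sub c hc n hn
  rw [← sub_nonneg, h, mul_nonneg_iff_of_pos_left hk]

theorem HB_succ_le_iff (c : ℝ) (hc : 0 < c) (n : ℕ) (hn : 2 ≤ n) :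
    HB (n + 1) c ≤ HB n c ↔ (3 * c - c ^ 2) * (n : ℝ) + c ^ 2 - c + 2 ≤ 0 := by
  obtain ⟨k, hk, h⟩ := HB_succ_sub c hc n hn
  rw [← sub_nonpos, h, mul_nonpos_iff_pos_imp_nonpos]
  exact ⟨fun h' => h'.1 hk, fun h' => ⟨fun _ => h', fun h'' => by linarith⟩⟩

/-- Proposition 9(ii) (analytic content): the integral formula for the expected highest bid,
the monotonicity criterion, and the two boundary monotonicity regimes. -/
theorem stmt_18 (c : ℝ) (hc : 0 < c) :
    (∀ n : ℕ, 2 ≤ n →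
      ((n : ℝ) - 1) * c *
          (∫ x in (0:ℝ)..1, x ^ (((n : ℝ) - 1) * c) * (1 - x ^ ((n : ℝ) * c)))
        = HB n c) ∧
    (∀ n : ℕ, 2 ≤ n →
      (HB (n + 1) c ≥ HB n c ↔ (3 * c - c ^ 2) * (n : ℝ) + c ^ 2 - c + 2 ≥ 0)) ∧
    (c ≤ 3 → ∀ n n' : ℕ, 2 ≤ n → n ≤ n' → HB n c ≤ HB n' c) ∧
    ((5 + Real.sqrt 33) / 2 ≤ c → ∀ n n' : ℕ, 2 ≤ n → n ≤ n' → HB n' c ≤ HB n c) := by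
  refine ⟨fun n hn => ?_, fun n hn => HB_le_succ_iff c hc n hn, fun h3 n n' hn hnn' => ?_,
    fun h5 n n' hn hnn' => ?_⟩
  · exact HB_integral n c hc (by exact_mod_cast (by omega : 1 ≤ n))
  · induction n', hnn' using Nat.le_induction with
    | base => exact le_rfl
    | succ m hm ih =>
      refine ih.trans ((HB_le_succ_iff c hc m (hn.trans hm)).2 ?_)
      have := mul_nonneg (mul_nonneg hc.le (sub_nonneg.2 h3)) (Nat.cast_nonneg (α := ℝ) m)
      nlinarith [sq_nonneg (c - 1)]
  · induction n', hnn' using Nat.le_induction with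
    | base => exact le_rfl
    | succ m hm ih =>
      refine ((HB_succ_le_iff c hc m (hn.trans hm)).2 ?_).trans ih
      have hm' : (2 : ℝ) ≤ m := by exact_mod_cast hn.trans hm
      have hs : Real.sqrt 33 ^ 2 = 33 := Real.sq_sqrt (by norm_num)
      have hs0 : 0 ≤ Real.sqrt 33 := Real.sqrt_nonneg 33
      have hroot : 0 ≤ c ^ 2 - 5 * c - 2 := by nlinarith
      have hc3 : 3 ≤ c := by nlinarith
      nlinarith [mul_nonneg (mul_nonneg hc.le (sub_nonneg.2 hc3)) (sub_nonneg.2 hm')]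
end
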